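/- Let P ⊂ B^d ⊂ ℝ^d be a convex polytope containing both the origin and a point c in its interior. Set K₁ = P° and K₂ = (P − c)°. Let v₁, …, v_k be extreme points of K₁ and let w_i = v_i/(1 − ⟨v_i, c⟩) for i = 1, …, k be the corresponding extreme points of K₂. If conv{w₁, …, w_k} ⊇ λ·B^d for some λ > 0, then conv{v₁, …, v_k} ⊇ (λ/(1+λ))·B^d. -/

import Mathlib

open Metric
open scoped RealInnerProductSpace

/-- The polar of a set `S ⊆ ℝ^d`: all `x` with `⟪x, s⟫ ≤ 1` for every `s ∈ S`. -/
def polarSet {d : ℕ} (S : Set (EuclideanSpace ℝ (Fin d))) : Set (EuclideanSpace ℝ (Fin d)) :=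
  {x | ∀ s ∈ S, ⟪x, s⟫ ≤ 1}

/-- A functional in the polar of a set takes values less than `1` on the interior. -/
lemma inner_lt_one_of_mem_polarSet {d : ℕ} {S : Set (EuclideanSpace ℝ (Fin d))}
    {v c : EuclideanSpace ℝ (Fin d)} (hv : v ∈ polarSet S) (hc : c ∈ interior S) :
    ⟪v, c⟫ < 1 := by
  obtain rfl | hv0 := eq_or_ne v 0
  · simp
  have hlim : Filter.Tendsto (fun t : ℝ => c + t • v) (nhds 0) (nhds c) := by
    have h : Continuous fun t : ℝ => c + t • v := by fun_prop
    simpa using h.tendsto 0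
  have hev : ∀ᶠ t in nhdsWithin (0 : ℝ) (Set.Ioi 0), c + t • v ∈ S :=
    (hlim.mono_left nhdsWithin_le_nhds).eventually (mem_interior_iff_mem_nhds.mp hc)
  obtain ⟨t, hmem, ht⟩ := (hev.and self_mem_nhdsWithin).exists
  have hle := hv _ hmem
  rw [inner_add_right, real_inner_smul_right] at hle
  have hpos := mul_pos (Set.mem_Ioi.mp ht) (real_inner_self_pos.mpr hv0)
  linarith

/-- The projective map `y ↦ (1 + ⟪y, c⟫)⁻¹ • y`, which sends each `(1 - ⟪v i, c⟫)⁻¹ • v i` to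
`v i`, sends convex combinations to convex combinations. -/
lemma mem_convexHull_of_projective {d : ℕ} {ι : Type*}
    {v : ι → EuclideanSpace ℝ (Fin d)} {c x : EuclideanSpace ℝ (Fin d)}
    (hv : ∀ i, ⟪v i, c⟫ < 1) (hx : ⟪x, c⟫ < 1)
    (h : (1 - ⟪x, c⟫)⁻¹ • x ∈
      convexHull ℝ (Set.range fun i => (1 - ⟪v i, c⟫)⁻¹ • v i)) :
    x ∈ convexHull ℝ (Set.range v) := by
  obtain ⟨κ, _, a, z, ha0, ha1, hz, hsum⟩ := mem_convexHull_iff_exists_fintype.mp h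
  choose g hg using hz
  obtain rfl : (fun k => (1 - ⟪v (g k), c⟫)⁻¹ • v (g k)) = z := funext hg
  have hx' : 0 < 1 - ⟪x, c⟫ := sub_pos.mpr hx
  have hv' : ∀ i, 0 < 1 - ⟪v i, c⟫ := fun i => sub_pos.mpr (hv i)
  have hmass : ∑ i, a i * (1 - ⟪v (g i), c⟫)⁻¹ = (1 - ⟪x, c⟫)⁻¹ := by
    have hinner := congrArg (fun y => ⟪y, c⟫) hsum
    simp only [sum_inner, real_inner_smul_left] at hinner
    have hterm : ∀ i, a i * (1 - ⟪v (g i), c⟫)⁻¹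
        = a i + a i * ((1 - ⟪v (g i), c⟫)⁻¹ * ⟪v (g i), c⟫) := by
      intro i
      have := (hv' (g i)).ne'
      field_simp
      ring
    rw [Finset.sum_congr rfl fun i _ => hterm i, Finset.sum_add_distrib, ha1, hinner]
    field_simp
    ring
  have hcomb : ∑ i, ((1 - ⟪x, c⟫) * (a i * (1 - ⟪v (g i), c⟫)⁻¹)) • v (g i) = x := by
    simp only [smul_smul] at hsum
    simp only [mul_smul (1 - ⟪x, c⟫)]
    rw [← Finset.smul_sum, hsum, smul_inv_smul₀ hx'.ne']
  rw [← hcomb]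
  refine (convex_convexHull ℝ _).sum_mem (fun i _ => ?_) ?_
    fun i _ => subset_convexHull ℝ _ (Set.mem_range_self (g i))
  · exact mul_nonneg hx'.le (mul_nonneg (ha0 i) (inv_nonneg.mpr (hv' (g i)).le))
  · rw [← Finset.mul_sum, hmass, mul_inv_cancel₀ hx'.ne']

/-- **Atlantis: there and back again.** Let `P ⊆ B^d` be a convex polytope containing the
origin and a point `c` in its interior, `K₁ = P°`, `K₂ = (P - c)°`. If extreme points
`v₁, …, v_k` of `K₁` have corresponding extreme points `w_i = (1 - ⟪v_i, c⟫)⁻¹ • v_i` of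
`K₂` whose convex hull contains `λ·B^d`, then the convex hull of `v₁, …, v_k` contains
`(λ/(1+λ))·B^d`. -/
theorem atlantis_there_and_back_again (d : ℕ) (F : Finset (EuclideanSpace ℝ (Fin d)))
    (P : Set (EuclideanSpace ℝ (Fin d)))
    (hP : P = convexHull ℝ (F : Set (EuclideanSpace ℝ (Fin d))))
    (hPball : P ⊆ closedBall (0 : EuclideanSpace ℝ (Fin d)) 1)
    (h0 : (0 : EuclideanSpace ℝ (Fin d)) ∈ interior P)
    (c : EuclideanSpace ℝ (Fin d)) (hc : c ∈ interior P)
    (K₁ K₂ : Set (EuclideanSpace ℝ (Fin d)))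
    (hK₁ : K₁ = polarSet P) (hK₂ : K₂ = polarSet ((fun x => x - c) '' P))
    (k : ℕ) (v : Fin k → EuclideanSpace ℝ (Fin d))
    (hv : ∀ i, v i ∈ Set.extremePoints ℝ K₁)
    (w : Fin k → EuclideanSpace ℝ (Fin d))
    (hw : ∀ i, w i = (1 - ⟪v i, c⟫)⁻¹ • v i)
    (hwext : ∀ i, w i ∈ Set.extremePoints ℝ K₂)
    (lam : ℝ) (hlam : 0 < lam)
    (hcontain : closedBall (0 : EuclideanSpace ℝ (Fin d)) lam ⊆ convexHull ℝ (Set.range w)) :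
    closedBall (0 : EuclideanSpace ℝ (Fin d)) (lam / (1 + lam)) ⊆
      convexHull ℝ (Set.range v) := by
  subst hK₁
  obtain rfl : w = fun i => (1 - ⟪v i, c⟫)⁻¹ • v i := funext hw
  intro x hx
  rw [mem_closedBall_zero_iff] at hx
  have hc1 : ‖c‖ ≤ 1 := mem_closedBall_zero_iff.mp (hPball (interior_subset hc))
  have hxc : ⟪x, c⟫ ≤ ‖x‖ :=
    (real_inner_le_norm x c).trans (mul_le_of_le_one_right (norm_nonneg x) hc1)
  have hx_mul : ‖x‖ * (1 + lam) ≤ lam := (le_div_iff₀ (by positivity)).mp hx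
  have hxc1 : ⟪x, c⟫ < 1 :=
    (hxc.trans hx).trans_lt ((div_lt_one (by positivity)).mpr (by linarith))
  refine mem_convexHull_of_projective
    (fun i => inner_lt_one_of_mem_polarSet (hv i).1 hc) hxc1 (hcontain ?_)
  have hpos : 0 < 1 - ⟪x, c⟫ := sub_pos.mpr hxc1
  rw [mem_closedBall_zero_iff, norm_smul, norm_inv, Real.norm_of_nonneg hpos.le,
    inv_mul_le_iff₀ hpos]
  nlinarith [mul_le_mul_of_nonneg_right hxc hlam.le]
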